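/- Let N ∈ ℕ and T > 0 be fixed. Then there exist constants c, C > 0 (depending only on N and T) such that for all φ ∈ (0,π) and 0 < t ≤ T: c·φ(π−φ)·(t+π−φ)^{-(N+1)}·t^{-(2N+1)/2−1}·exp(−φ²/(4t)) ≤ (2π)^{-N} e^{tN²}·sin φ·((−D)^{N+1} θ_t)(φ) ≤ C·φ(π−φ)·(t+π−φ)^{-(N+1)}·t^{-(2N+1)/2−1}·exp(−φ²/(4t)). (The middle expression equals −∂_φ K_t^{2N+1}(φ), the negative derivative of the heat kernel of S^{2N+1} in geodesic distance; in particular this derivative is strictly negative on (0,π).) -/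

import Mathlib

/-- The one-dimensional Gauss-Weierstrass kernel `W_t(x) = (4*pi*t)^(-1/2) exp(-x^2/(4t))`. -/
noncomputable def W (t x : ℝ) : ℝ :=
  (1 / Real.sqrt (4 * Real.pi * t)) * Real.exp (-x ^ 2 / (4 * t))

/-- The 2*pi-periodization of `W t` (heat kernel of the circle). -/
noncomputable def theta (t φ : ℝ) : ℝ := ∑' n : ℤ, W t (φ + 2 * Real.pi * n)

/-- The operator `f ↦ -(1/sin φ) * f'`. -/
noncomputable def negD (f : ℝ → ℝ) : ℝ → ℝ := fun φ => -(deriv f φ / Real.sin φ)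

open Filter Topology

/-- finite q-Pochhammer -/
noncomputable def qp (Q : ℝ) (n : ℕ) : ℝ := ∏ i ∈ Finset.range n, (1 - Q ^ (i + 1))

/-- reciprocal, extended by zero to negative integers -/
noncomputable def rr (Q : ℝ) (j : ℤ) : ℝ := if 0 ≤ j then (qp Q j.toNat)⁻¹ else 0

lemma one_sub_pow_pos' {Q : ℝ} (h0 : 0 < Q) (h1 : Q < 1) (i : ℕ) : 0 < 1 - Q ^ (i + 1) := by
  have := pow_lt_one₀ h0.le h1 (Nat.succ_ne_zero i)
  simpa using this

lemma qp_pos {Q : ℝ} (h0 : 0 < Q) (h1 : Q < 1) (n : ℕ) : 0 < qp Q n :=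
  Finset.prod_pos fun i _ => one_sub_pow_pos' h0 h1 i

lemma qp_succ (Q : ℝ) (n : ℕ) : qp Q (n + 1) = qp Q n * (1 - Q ^ (n + 1)) :=
  Finset.prod_range_succ _ _

lemma qp_anti {Q : ℝ} (h0 : 0 < Q) (h1 : Q < 1) : Antitone (qp Q) := by
  refine antitone_nat_of_succ_le fun n => ?_
  rw [qp_succ]
  have := qp_pos h0 h1 n
  have h2 : 0 < Q ^ (n + 1) := by positivity
  nlinarith

lemma qp_lim {Q : ℝ} (h0 : 0 < Q) (h1 : Q < 1) :
    ∃ L : ℝ, 0 < L ∧ Tendsto (qp Q) atTop (𝓝 L) ∧ ∀ n, L ≤ qp Q n := by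
  have hs : Summable (fun i : ℕ => ‖-Q ^ (i + 1)‖) := by
    simp only [norm_neg, norm_pow]
    refine (summable_nat_add_iff 1).2 (summable_geometric_of_lt_one (norm_nonneg _) ?_)
    rw [Real.norm_eq_abs, abs_of_pos h0]; exact h1
  have hm := multipliable_one_add_of_summable hs
  have hne : ∏' i : ℕ, (1 + -Q ^ (i + 1)) ≠ 0 := by
    refine tprod_one_add_ne_zero_of_summable (fun i => ?_) hs
    have := one_sub_pow_pos' h0 h1 i
    linarith
  have ht : Tendsto (qp Q) atTop (𝓝 (∏' i : ℕ, (1 + -Q ^ (i + 1)))) := by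
    have := hm.hasProd.tendsto_prod_nat
    have e : qp Q = fun n => ∏ i ∈ Finset.range n, (1 + -Q ^ (i + 1)) := by
      funext n; simp [qp, sub_eq_add_neg]
    rw [e]; exact this
  have hle : ∀ n, (∏' i : ℕ, (1 + -Q ^ (i + 1))) ≤ qp Q n := fun n => (qp_anti h0 h1).le_of_tendsto ht n
  refine ⟨_, lt_of_le_of_ne ?_ hne.symm, ht, hle⟩
  exact ge_of_tendsto' ht fun n => (qp_pos h0 h1 n).le

lemma rr_rec {Q : ℝ} (h0 : 0 < Q) (h1 : Q < 1) (j : ℤ) : rr Q (j - 1) = (1 - Q ^ j) * rr Q j := by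
  unfold rr
  rcases lt_trichotomy j 0 with h | h | h
  · rw [if_neg (by omega), if_neg (by omega)]; simp
  · subst h; simp
  · obtain ⟨n, rfl⟩ : ∃ n : ℕ, j = n + 1 := ⟨(j - 1).toNat, by omega⟩
    rw [if_pos (by omega), if_pos (by omega)]
    have e1 : ((n : ℤ) + 1 - 1).toNat = n := by omega
    have e2 : ((n : ℤ) + 1).toNat = n + 1 := by omega
    rw [e1, e2, qp_succ]
    have := qp_pos h0 h1 n
    have h3 := one_sub_pow_pos' h0 h1 n
    have e3 : Q ^ ((n : ℤ) + 1) = Q ^ (n + 1) := by exact_mod_cast zpow_natCast Q (n + 1)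
    rw [e3]; field_simp

/-- coefficients in the finite Jacobi triple product -/
noncomputable def cc (Q : ℝ) (m : ℕ) (k : ℤ) : ℝ := qp Q (2 * m) * rr Q (m - k) * rr Q (m + k)

lemma cc_rec {Q : ℝ} (h0 : 0 < Q) (h1 : Q < 1) (m : ℕ) (k : ℤ) :
    cc Q (m + 1) k = (1 + Q ^ (2 * m + 1)) * cc Q m k + Q ^ ((m : ℤ) + 1 - k) * cc Q m (k - 1)
      + Q ^ ((m : ℤ) + 1 + k) * cc Q m (k + 1) := by
  unfold cc
  have hq : Q ≠ 0 := h0.ne'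
  have a1 := rr_rec h0 h1 ((m : ℤ) + 1 - k)
  have a2 := rr_rec h0 h1 ((m : ℤ) + 1 - k - 1)
  have b1 := rr_rec h0 h1 ((m : ℤ) + 1 + k)
  have b2 := rr_rec h0 h1 ((m : ℤ) + 1 + k - 1)
  have e : 2 * (m + 1) = 2 * m + 1 + 1 := by ring
  rw [e, qp_succ, qp_succ]
  have f1 : (m : ℤ) - k = (m : ℤ) + 1 - k - 1 := by ring
  have f2 : (m : ℤ) + k = (m : ℤ) + 1 + k - 1 := by ring
  have f3 : (m : ℤ) - (k - 1) = (m : ℤ) + 1 - k := by ring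
  have f4 : (m : ℤ) + (k - 1) = (m : ℤ) + 1 + k - 1 - 1 := by ring
  have f5 : (m : ℤ) - (k + 1) = (m : ℤ) + 1 - k - 1 - 1 := by ring
  have f6 : (m : ℤ) + (k + 1) = (m : ℤ) + 1 + k := by ring
  push_cast
  rw [f3, f4, f5, f6, f1, f2, a2, b2, a1, b1, zpow_sub_one₀ hq, zpow_sub_one₀ hq]
  have g1 : Q ^ (2 * m + 1 + 1) = Q ^ ((m : ℤ) + 1 - k) * Q ^ ((m : ℤ) + 1 + k) := by
    rw [← zpow_add₀ hq, ← zpow_natCast]; congr 1; push_cast; ring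
  have g2 : Q ^ (2 * m + 1) = Q ^ ((m : ℤ) + 1 - k) * Q ^ ((m : ℤ) + 1 + k) * Q⁻¹ := by
    rw [← g1, pow_succ _ (2 * m + 1), mul_assoc, mul_inv_cancel₀ hq, mul_one]
  rw [g1, g2]
  generalize Q ^ ((m : ℤ) + 1 - k) = X
  generalize Q ^ ((m : ℤ) + 1 + k) = Y
  ring

lemma cc_zero (Q : ℝ) (k : ℤ) : cc Q 0 k = if k = 0 then 1 else 0 := by
  unfold cc rr
  rcases lt_trichotomy k 0 with h | h | h
  · rw [if_neg (c := 0 ≤ ((0:ℕ):ℤ) + k) (by push_cast; omega), if_neg (c := k = 0) (by omega)]; simp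
  · subst h; simp [qp]
  · rw [if_neg (c := 0 ≤ ((0:ℕ):ℤ) - k) (by push_cast; omega), if_neg (c := k = 0) (by omega)]; simp

lemma triple_finite {q : ℝ} (h0 : 0 < q) (h1 : q < 1) (z : ℂ) (hz : z ≠ 0) (m : ℕ) :
    HasSum (fun k : ℤ => (cc (q ^ 2) m k : ℂ) * (q : ℂ) ^ (k ^ 2) * z ^ k)
      (∏ n ∈ Finset.range m, ((1 : ℂ) + (q : ℂ) ^ (2 * (2 * n + 1)) + q ^ (2 * n + 1) * (z + z⁻¹))) := by
  have hq : (q : ℂ) ≠ 0 := by exact_mod_cast h0.ne'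
  induction m with
  | zero =>
    have : (fun k : ℤ => (cc (q ^ 2) 0 k : ℂ) * (q : ℂ) ^ (k ^ 2) * z ^ k) =
        fun k => if k = 0 then 1 else 0 := by
      funext k; rw [cc_zero]; split_ifs with h
      · subst h; simp
      · simp
    rw [this]; simpa using hasSum_ite_eq (0 : ℤ) (1 : ℂ)
  | succ m ih =>
    rw [Finset.prod_range_succ]
    have s1 := ih.mul_left ((1 : ℂ) + (q : ℂ) ^ (2 * (2 * m + 1)))
    have s2 := ((Equiv.subRight (1 : ℤ)).hasSum_iff.2 ih).mul_left ((q : ℂ) ^ (2 * m + 1) * z)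
    have s3 := ((Equiv.addRight (1 : ℤ)).hasSum_iff.2 ih).mul_left ((q : ℂ) ^ (2 * m + 1) * z⁻¹)
    have s := (s1.add s2).add s3
    convert! s using 1
    · funext k
      simp only [Function.comp, Equiv.subRight_apply, Equiv.coe_addRight]
      rw [cc_rec (by positivity) (by nlinarith)]
      push_cast
      have e1 : ((q : ℂ) ^ 2) ^ ((m : ℤ) + 1 - k) * (q : ℂ) ^ (k ^ 2) =
          (q : ℂ) ^ (2 * m + 1) * (q : ℂ) ^ ((k - 1) ^ 2) := by
        rw [← zpow_natCast, ← zpow_mul, ← zpow_natCast, ← zpow_add₀ hq, ← zpow_add₀ hq]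
        congr 1; push_cast; ring
      have e2 : ((q : ℂ) ^ 2) ^ ((m : ℤ) + 1 + k) * (q : ℂ) ^ (k ^ 2) =
          (q : ℂ) ^ (2 * m + 1) * (q : ℂ) ^ ((k + 1) ^ 2) := by
        rw [← zpow_natCast, ← zpow_mul, ← zpow_natCast, ← zpow_add₀ hq, ← zpow_add₀ hq]
        congr 1; push_cast; ring
      have e3 : z ^ k = z * z ^ (k - 1) := by rw [zpow_sub_one₀ hz]; field_simp
      have e4 : z ^ k = z⁻¹ * z ^ (k + 1) := by rw [zpow_add_one₀ hz]; field_simp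
      calc _ = (1 + ((q:ℂ) ^ 2) ^ (2 * m + 1)) * (cc (q ^ 2) m k) * (q : ℂ) ^ (k ^ 2) * z ^ k
            + (((q : ℂ) ^ 2) ^ ((m : ℤ) + 1 - k) * (q : ℂ) ^ (k ^ 2)) * (cc (q ^ 2) m (k - 1)) * z ^ k
            + (((q : ℂ) ^ 2) ^ ((m : ℤ) + 1 + k) * (q : ℂ) ^ (k ^ 2)) * (cc (q ^ 2) m (k + 1)) * z ^ k := by ring
        _ = (1 + ((q:ℂ) ^ 2) ^ (2 * m + 1)) * (cc (q ^ 2) m k) * (q : ℂ) ^ (k ^ 2) * z ^ k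
            + (((q : ℂ) ^ 2) ^ ((m : ℤ) + 1 - k) * (q : ℂ) ^ (k ^ 2)) * (cc (q ^ 2) m (k - 1)) * (z * z ^ (k - 1))
            + (((q : ℂ) ^ 2) ^ ((m : ℤ) + 1 + k) * (q : ℂ) ^ (k ^ 2)) * (cc (q ^ 2) m (k + 1)) * (z⁻¹ * z ^ (k + 1)) := by
              rw [← e3, ← e4]
        _ = _ := by rw [e1, e2, ← pow_mul]; ring
    · ring

lemma cc_bound {Q L : ℝ} (h0 : 0 < Q) (h1 : Q < 1) (hL : 0 < L) (hle : ∀ n, L ≤ qp Q n) (m : ℕ) (k : ℤ) :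
    ‖cc Q m k‖ ≤ L⁻¹ * L⁻¹ := by
  have hr : ∀ j, 0 ≤ rr Q j ∧ rr Q j ≤ L⁻¹ := by
    intro j; unfold rr; split_ifs
    · exact ⟨inv_nonneg.2 (qp_pos h0 h1 _).le, inv_anti₀ hL (hle _)⟩
    · exact ⟨le_rfl, inv_nonneg.2 hL.le⟩
  have hq : qp Q (2 * m) ≤ 1 := by simpa [qp] using qp_anti h0 h1 (Nat.zero_le (2 * m))
  have hq0 := (qp_pos h0 h1 (2 * m)).le
  obtain ⟨a, b⟩ := hr (m - k); obtain ⟨c, d⟩ := hr (m + k)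
  unfold cc
  rw [Real.norm_of_nonneg (by positivity)]
  calc _ ≤ 1 * L⁻¹ * L⁻¹ := by gcongr
    _ = _ := by ring

lemma cc_tendsto {Q L : ℝ} (hL : 0 < L) (ht : Tendsto (qp Q) atTop (𝓝 L)) (k : ℤ) :
    Tendsto (fun m => cc Q m k) atTop (𝓝 L⁻¹) := by
  have h2 : Tendsto (fun m : ℕ => 2 * m) atTop atTop := by
    exact tendsto_id.const_mul_atTop' (by norm_num)
  have key : ∀ k : ℤ, Tendsto (fun m : ℕ => rr Q (m + k)) atTop (𝓝 L⁻¹) := by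
    intro k
    have hk : Tendsto (fun m : ℕ => ((m : ℤ) + k).toNat) atTop atTop := by
      refine tendsto_atTop.2 fun b => ?_
      filter_upwards [eventually_ge_atTop (b + k.natAbs)] with m hm
      omega
    refine ((ht.comp hk).inv₀ hL.ne').congr' ?_
    filter_upwards [eventually_ge_atTop (k.natAbs)] with m hm
    simp only [rr, Function.comp]; rw [if_pos (by omega)]
  have := ((ht.comp h2).mul (key (-k))).mul (key k)
  rw [mul_inv_cancel₀ hL.ne', one_mul] at this
  simpa [cc, Function.comp, sub_eq_add_neg] using this

lemma summable_qsq {q : ℝ} (h0 : 0 < q) (h1 : q < 1) : Summable (fun k : ℤ => q ^ (k ^ 2)) := by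
  have h : Summable (fun n : ℕ => q ^ ((n : ℤ) ^ 2)) := by
    refine Summable.of_nonneg_of_le (fun n => by positivity) (fun n => ?_)
      (summable_geometric_of_lt_one h0.le h1)
    have : q ^ ((n : ℤ) ^ 2) = q ^ (n ^ 2) := by exact_mod_cast zpow_natCast q (n ^ 2)
    rw [this]
    exact pow_le_pow_of_le_one h0.le h1.le (Nat.le_self_pow (by norm_num) n)
  refine Summable.of_nat_of_neg h ?_
  simpa using h

lemma triple_limit {q : ℝ} (h0 : 0 < q) (h1 : q < 1) :
    ∃ L : ℝ, 0 < L ∧ (∀ φ : ℝ, 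
    Tendsto (fun m => ∏ n ∈ Finset.range m, ((1 : ℂ) + (q : ℂ) ^ (2 * (2 * n + 1)) + 2 * q ^ (2 * n + 1) * (Real.cos φ : ℂ)))
     atTop (𝓝 ((L : ℂ)⁻¹ * ∑' k : ℤ, (q : ℂ) ^ (k ^ 2) * Complex.exp (φ * Complex.I) ^ k))) := by
  have hQ1 : q ^ 2 < 1 := by nlinarith
  obtain ⟨L, hL, ht, hle⟩ := qp_lim (Q := q ^ 2) (by positivity) hQ1
  refine ⟨L, hL, fun φ => ?_⟩
  have hz : Complex.exp (φ * Complex.I) ≠ 0 := Complex.exp_ne_zero _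
  have hcos : Complex.exp (φ * Complex.I) + (Complex.exp (φ * Complex.I))⁻¹ = 2 * (Real.cos φ : ℂ) := by
    rw [← Complex.exp_neg, Complex.ofReal_cos, Complex.cos]; ring_nf
  have hn : ∀ k : ℤ, ‖Complex.exp (φ * Complex.I) ^ k‖ = 1 := by
    intro k; rw [norm_zpow, Complex.norm_exp_ofReal_mul_I, one_zpow]
  have := tendsto_tsum_of_dominated_convergence (𝓕 := atTop)
    (f := fun m k => (cc (q ^ 2) m k : ℂ) * (q : ℂ) ^ (k ^ 2) * Complex.exp (φ * Complex.I) ^ k)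
    (g := fun k : ℤ => (L : ℂ)⁻¹ * ((q : ℂ) ^ (k ^ 2) * Complex.exp (φ * Complex.I) ^ k))
    (bound := fun k => L⁻¹ * L⁻¹ * q ^ (k ^ 2)) ((summable_qsq h0 h1).mul_left _) ?_ ?_
  · rw [tsum_mul_left] at this
    refine this.congr fun m => ?_
    rw [(triple_finite h0 h1 _ hz m).tsum_eq]
    refine Finset.prod_congr rfl fun n _ => ?_
    rw [hcos]; ring
  · intro k
    have h := (cc_tendsto hL ht k).ofReal
    have h2 := h.mul_const ((q : ℂ) ^ (k ^ 2) * Complex.exp (φ * Complex.I) ^ k)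
    simpa [mul_assoc] using h2
  · refine Eventually.of_forall fun m k => ?_
    rw [norm_mul, norm_mul, hn, mul_one, norm_zpow, Complex.norm_real, Complex.norm_real,
      Real.norm_of_nonneg h0.le]
    gcongr
    exact cc_bound (by positivity) hQ1 hL hle m k

lemma theta_poisson {t : ℝ} (ht : 0 < t) (φ : ℝ) :
    (theta t φ : ℂ) = (1 / (2 * Real.pi) : ℝ) *
      ∑' k : ℤ, ((Real.exp (-t) : ℝ) : ℂ) ^ (k ^ 2) * Complex.exp (φ * Complex.I) ^ k := by
  have hpi := Real.pi_pos
  have ha : 0 < ((t / Real.pi : ℝ) : ℂ).re := by rw [Complex.ofReal_re]; positivity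
  have key := Complex.tsum_exp_neg_quadratic ha ((φ / (2 * Real.pi) : ℝ) * Complex.I)
  have l : (∑' k : ℤ, ((Real.exp (-t) : ℝ) : ℂ) ^ (k ^ 2) * Complex.exp (φ * Complex.I) ^ k) =
      ∑' n : ℤ, Complex.exp (-Real.pi * ((t / Real.pi : ℝ) : ℂ) * n ^ 2 +
        2 * Real.pi * ((φ / (2 * Real.pi) : ℝ) * Complex.I) * n) := by
    refine tsum_congr fun k => ?_
    rw [Complex.ofReal_exp, ← Complex.exp_int_mul, ← Complex.exp_int_mul, ← Complex.exp_add]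
    congr 1
    have : (Real.pi : ℂ) ≠ 0 := by exact_mod_cast hpi.ne'
    push_cast; field_simp
    try ring
  rw [l, key]
  unfold theta
  rw [← (Equiv.neg ℤ).tsum_eq (fun n : ℤ => W t (φ + 2 * Real.pi * n)), Complex.ofReal_tsum, ← mul_assoc, ← tsum_mul_left]
  refine tsum_congr fun n => ?_
  have e2 : ((t / Real.pi : ℝ) : ℂ) ^ (1 / 2 : ℂ) = ((Real.sqrt (t / Real.pi) : ℝ) : ℂ) := by
    rw [Real.sqrt_eq_rpow, Complex.ofReal_cpow (by positivity)]; norm_num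
  rw [e2]
  have e3 : -(Real.pi : ℂ) / ((t / Real.pi : ℝ) : ℂ) * (n + Complex.I * ((φ / (2 * Real.pi) : ℝ) * Complex.I)) ^ 2
      = ((-(φ + 2 * Real.pi * ((Equiv.neg ℤ n : ℤ) : ℝ)) ^ 2 / (4 * t) : ℝ) : ℂ) := by
    have : (Real.pi : ℂ) ≠ 0 := by exact_mod_cast hpi.ne'
    have ht' : (t : ℂ) ≠ 0 := by exact_mod_cast ht.ne'
    have : Complex.I * ((φ / (2 * Real.pi) : ℝ) * Complex.I) = -((φ / (2 * Real.pi) : ℝ) : ℂ) := by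
      rw [mul_comm, mul_assoc, Complex.I_mul_I]; ring
    rw [this]
    simp only [Equiv.neg_apply]
    push_cast; field_simp
    ring
  rw [e3, ← Complex.ofReal_exp]
  unfold W
  have e4 : 1 / Real.sqrt (4 * Real.pi * t) = 1 / (2 * Real.pi) * (1 / Real.sqrt (t / Real.pi)) := by
    have : 4 * Real.pi * t = (2 * Real.pi) ^ 2 * (t / Real.pi) := by field_simp; ring
    rw [this, Real.sqrt_mul (by positivity), Real.sqrt_sq (by positivity)]
    rw [one_div_mul_one_div]
  rw [e4]
  push_cast
  ring

lemma theta_product {t : ℝ} (ht : 0 < t) :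
    ∃ A : ℝ, 0 < A ∧ ∀ φ : ℝ, 
    Tendsto (fun m => ∏ n ∈ Finset.range m, ((1 : ℂ) + (Real.exp (-t) : ℂ) ^ (2 * (2 * n + 1)) +
      2 * (Real.exp (-t) : ℂ) ^ (2 * n + 1) * (Real.cos φ : ℂ)))
     atTop (𝓝 ((A * theta t φ : ℝ) : ℂ)) := by
  have hpi := Real.pi_pos
  obtain ⟨L, hL, h⟩ := triple_limit (Real.exp_pos (-t)) (by simpa using ht)
  refine ⟨L⁻¹ * (2 * Real.pi), by positivity, fun φ => ?_⟩
  convert h φ using 2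
  have := theta_poisson ht φ
  rw [Complex.ofReal_mul, this]
  have : (Real.pi : ℂ) ≠ 0 := by exact_mod_cast hpi.ne'
  push_cast
  field_simp

open Polynomial in
/-- finite product of affine factors -/
noncomputable def pq (α β : ℕ → ℝ) (s : Finset ℕ) : Polynomial ℝ := ∏ n ∈ s, (C (α n) + C (β n) * X)

open Polynomial in
lemma pq_deriv (α β : ℕ → ℝ) (s : Finset ℕ) :
    derivative (pq α β s) = ∑ n ∈ s, C (β n) * pq α β (s.erase n) := by
  unfold pq
  rw [derivative_prod_finset]
  refine Finset.sum_congr rfl fun n _ => ?_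
  simp
  ring

open Polynomial in
lemma pq_iter (α β : ℕ → ℝ) (s : Finset ℕ) (M : ℕ) (x : ℝ) :
    eval x (derivative^[M + 1] (pq α β s)) =
      ∑ n ∈ s, β n * eval x (derivative^[M] (pq α β (s.erase n))) := by
  rw [Function.iterate_succ_apply, pq_deriv, iterate_derivative_sum, eval_finsetSum]
  refine Finset.sum_congr rfl fun n _ => ?_
  rw [iterate_derivative_C_mul, eval_mul, eval_C]

open Polynomial in
lemma pq_eval (α β : ℕ → ℝ) (s : Finset ℕ) (x : ℝ) :
    eval x (pq α β s) = ∏ n ∈ s, (α n + β n * x) := by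
  unfold pq; rw [eval_prod]; simp

open Polynomial in
lemma pq_upper (α β : ℕ → ℝ) (x : ℝ) (hβ : ∀ n, 0 ≤ β n) (hl : ∀ n, 0 < α n + β n * x) (M : ℕ) :
    ∀ s : Finset ℕ, eval x (derivative^[M] (pq α β s)) ≤
      (∑ n ∈ s, β n / (α n + β n * x)) ^ M * eval x (pq α β s) := by
  have hb : ∀ n, 0 ≤ β n / (α n + β n * x) := fun n => div_nonneg (hβ n) (hl n).le
  induction M with
  | zero => intro s; simp
  | succ M ih =>
    intro s
    rw [pq_iter]
    calc _ ≤ ∑ n ∈ s, (β n / (α n + β n * x)) *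
          ((∑ n ∈ s, β n / (α n + β n * x)) ^ M * eval x (pq α β s)) := by
          refine Finset.sum_le_sum fun n hn => ?_
          have h1 := ih (s.erase n)
          have h2 : eval x (pq α β s) = (α n + β n * x) * eval x (pq α β (s.erase n)) := by
            rw [pq_eval, pq_eval, Finset.mul_prod_erase s (fun n => α n + β n * x) hn]
          have h3 : 0 ≤ eval x (pq α β (s.erase n)) := by
            rw [pq_eval]; exact Finset.prod_nonneg fun i _ => (hl i).le
          have h4 : (∑ n ∈ s.erase n, β n / (α n + β n * x)) ≤ ∑ n ∈ s, β n / (α n + β n * x) :=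
            Finset.sum_le_sum_of_subset_of_nonneg (Finset.erase_subset _ _) fun i _ _ => hb i
          have h5 : 0 ≤ (∑ n ∈ s.erase n, β n / (α n + β n * x)) := Finset.sum_nonneg fun i _ => hb i
          calc _ ≤ β n * ((∑ n ∈ s, β n / (α n + β n * x)) ^ M * eval x (pq α β (s.erase n))) := by
                refine mul_le_mul_of_nonneg_left (h1.trans ?_) (hβ n)
                gcongr
            _ = _ := by
                rw [h2]; have := (hl n).ne'
                generalize (∑ n ∈ s, β n / (α n + β n * x)) = S
                field_simp
      _ = _ := by rw [← Finset.sum_mul, pow_succ]; ring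

open Polynomial in
lemma pq_lower (α β : ℕ → ℝ) (x : ℝ) (hβ : ∀ n, 0 ≤ β n) (hl : ∀ n, 0 < α n + β n * x)
    (σ : ℝ) (hσ : 0 ≤ σ) (M : ℕ) :
    ∀ s : Finset ℕ, (∀ r ⊆ s, (s \ r).card < M → σ ≤ ∑ n ∈ r, β n / (α n + β n * x)) →
      σ ^ M * eval x (pq α β s) ≤ eval x (derivative^[M] (pq α β s)) := by
  induction M with
  | zero => intro s _; simp
  | succ M ih =>
    intro s hs
    rw [pq_iter]
    have h0 : 0 ≤ eval x (pq α β s) := by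
      rw [pq_eval]; exact Finset.prod_nonneg fun i _ => (hl i).le
    have hss := hs s (Finset.Subset.refl s) (by simp)
    calc _ = σ * (σ ^ M * eval x (pq α β s)) := by ring
      _ ≤ (∑ n ∈ s, β n / (α n + β n * x)) * (σ ^ M * eval x (pq α β s)) := by gcongr
      _ = ∑ n ∈ s, (β n / (α n + β n * x)) * (σ ^ M * eval x (pq α β s)) := by rw [Finset.sum_mul]
      _ ≤ _ := by
          refine Finset.sum_le_sum fun n hn => ?_
          have h1 := ih (s.erase n) (fun r hr hc => hs r (hr.trans (Finset.erase_subset _ _)) (by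
            have : s \ r ⊆ insert n (s.erase n \ r) := by
              intro a; simp only [Finset.mem_sdiff, Finset.mem_insert, Finset.mem_erase]; tauto
            have := (Finset.card_le_card this).trans (Finset.card_insert_le _ _)
            omega))
          have h2 : eval x (pq α β s) = (α n + β n * x) * eval x (pq α β (s.erase n)) := by
            rw [pq_eval, pq_eval, Finset.mul_prod_erase s (fun n => α n + β n * x) hn]
          calc _ = β n * (σ ^ M * eval x (pq α β (s.erase n))) := by
                rw [h2]; have := (hl n).ne'; field_simp
            _ ≤ _ := mul_le_mul_of_nonneg_left h1 (hβ n)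

open Polynomial in
lemma tlu_iter (p : ℕ → Polynomial ℝ) (G : ℂ → ℂ) (U : Set ℂ) (hU : IsOpen U)
    (h : TendstoLocallyUniformlyOn (fun m z => aeval z (p m)) G atTop U) (M : ℕ) :
    TendstoLocallyUniformlyOn (fun m z => aeval z (derivative^[M] (p m))) (deriv^[M] G) atTop U := by
  induction M with
  | zero => simpa using h
  | succ M ih =>
    have hd : ∀ m, Differentiable ℂ (fun z : ℂ => aeval z (derivative^[M] (p m))) :=
      fun m => (derivative^[M] (p m)).differentiable_aeval
    have := ih.deriv (Eventually.of_forall fun m => (hd m).differentiableOn) hU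
    rw [Function.iterate_succ_apply']
    refine this.congr fun m z hz => ?_
    simp only [Function.comp]
    rw [Polynomial.deriv_aeval, Function.iterate_succ_apply']

open Polynomial in
/-- the entire function and its derivatives -/
lemma limit_package (p : ℕ → Polynomial ℝ) (G : ℂ → ℂ) (U : Set ℂ) (hU : IsOpen U)
    (h : TendstoLocallyUniformlyOn (fun m z => aeval z (p m)) G atTop U) :
    ∃ g : ℕ → ℝ → ℝ, ∀ M, ∀ x : ℝ, (x : ℂ) ∈ U →
      Tendsto (fun m => eval x (derivative^[M] (p m))) atTop (𝓝 (g M x)) ∧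
      HasDerivAt (g M) (g (M + 1) x) x := by
  refine ⟨fun M x => (deriv^[M] G x).re, fun M x hx => ⟨?_, ?_⟩⟩
  · have h1 := (tlu_iter p G U hU h M).tendsto_at hx
    have h2 := (Complex.continuous_re.tendsto _).comp h1
    refine h2.congr fun m => ?_
    simp only [Function.comp]
    have : aeval (x : ℂ) (derivative^[M] (p m)) = ((eval x (derivative^[M] (p m)) : ℝ) : ℂ) := by
      have := Polynomial.aeval_algebraMap_apply ℂ x (derivative^[M] (p m))
      simpa using this
    rw [this, Complex.ofReal_re]
  · have hd : DifferentiableOn ℂ (deriv^[M] G) U :=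
      (tlu_iter p G U hU h M).differentiableOn
        (Eventually.of_forall fun m => ((derivative^[M] (p m)).differentiable_aeval).differentiableOn) hU
    have := (hd.differentiableAt (hU.mem_nhds hx)).hasDerivAt.real_of_complex
    simpa only [Function.iterate_succ_apply'] using this

/-- constant coefficients -/
noncomputable def al (t : ℝ) (n : ℕ) : ℝ := 1 + Real.exp (-t) ^ (2 * (2 * n + 1))
/-- linear coefficients -/
noncomputable def be (t : ℝ) (n : ℕ) : ℝ := 2 * Real.exp (-t) ^ (2 * n + 1)

open Polynomial in
lemma prod_tlu {t : ℝ} (ht : 0 < t) : ∃ G : ℂ → ℂ,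
    TendstoLocallyUniformlyOn (fun m z => aeval z (pq (al t) (be t) (Finset.range m))) G atTop
      (Metric.ball (0 : ℂ) 2) := by
  set q := Real.exp (-t) with hq
  have h0 : 0 < q := Real.exp_pos _
  have h1 : q < 1 := by rw [hq]; simpa using ht
  have hs : Summable (fun n : ℕ => 5 * q ^ n) := (summable_geometric_of_lt_one h0.le h1).mul_left 5
  have := Summable.hasProdLocallyUniformlyOn_nat_one_add (f := fun (n : ℕ) (z : ℂ) =>
    (q : ℂ) ^ (2 * (2 * n + 1)) + 2 * (q : ℂ) ^ (2 * n + 1) * z) (K := Metric.ball (0 : ℂ) 2)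
    Metric.isOpen_ball hs (Eventually.of_forall fun n z hz => by
      have hz : ‖z‖ < 2 := by simpa using hz
      refine (norm_add_le _ _).trans ?_
      rw [norm_mul, norm_mul, norm_pow, norm_pow, Complex.norm_real, Real.norm_of_nonneg h0.le]
      have a : q ^ (2 * (2 * n + 1)) ≤ q ^ n := pow_le_pow_of_le_one h0.le h1.le (by omega)
      have b : q ^ (2 * n + 1) ≤ q ^ n := pow_le_pow_of_le_one h0.le h1.le (by omega)
      have c : 0 ≤ q ^ n := by positivity
      have d : 0 ≤ q ^ (2 * n + 1) := by positivity
      have : ‖(2 : ℂ)‖ = 2 := by simp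
      rw [this]
      nlinarith [norm_nonneg z]) (fun n => by fun_prop)
  refine ⟨_, this.tendstoLocallyUniformlyOn_finsetRange.congr fun m z hz => ?_⟩
  simp only [pq, map_prod]
  refine Finset.prod_congr rfl fun n _ => ?_
  simp [al, be, ← hq]
  ring

open Polynomial in
lemma transfer {t : ℝ} (ht : 0 < t) (M : ℕ) {φ : ℝ} (hφ : φ ∈ Set.Ioo 0 Real.pi) (lo hi : ℝ)
    (hlo : ∀ᶠ m in atTop, lo * eval (Real.cos φ) (pq (al t) (be t) (Finset.range m)) ≤
      eval (Real.cos φ) (derivative^[M] (pq (al t) (be t) (Finset.range m))))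
    (hhi : ∀ᶠ m in atTop, eval (Real.cos φ) (derivative^[M] (pq (al t) (be t) (Finset.range m))) ≤
      hi * eval (Real.cos φ) (pq (al t) (be t) (Finset.range m))) :
    lo * theta t φ ≤ (negD^[M] (theta t)) φ ∧ (negD^[M] (theta t)) φ ≤ hi * theta t φ := by
  obtain ⟨G, hG⟩ := prod_tlu ht
  obtain ⟨g, hg⟩ := limit_package _ G _ Metric.isOpen_ball hG
  obtain ⟨A, hA, hAt⟩ := theta_product ht
  have hmem : ∀ ψ : ℝ, ((Real.cos ψ : ℝ) : ℂ) ∈ Metric.ball (0 : ℂ) 2 := by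
    intro ψ
    rw [mem_ball_zero_iff, Complex.norm_real, Real.norm_eq_abs]
    linarith [Real.abs_cos_le_one ψ]
  have hθ : ∀ ψ, theta t ψ = A⁻¹ * g 0 (Real.cos ψ) := by
    intro ψ
    have h1 := (hg 0 _ (hmem ψ)).1
    have h2 := (Complex.continuous_re.tendsto _).comp (hAt ψ)
    rw [Complex.ofReal_re] at h2
    have h3 : A * theta t ψ = g 0 (Real.cos ψ) := by
      refine tendsto_nhds_unique (h2.congr fun m => ?_) h1
      simp only [Function.comp, Function.iterate_zero, id]
      rw [pq_eval]
      rw [← Complex.ofReal_re (∏ n ∈ Finset.range m, (al t n + be t n * Real.cos ψ))]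
      congr 1
      push_cast
      refine Finset.prod_congr rfl fun n _ => ?_
      simp [al, be]
    rw [← h3]; field_simp
  have hD : ∀ M, ∀ ψ ∈ Set.Ioo 0 Real.pi, (negD^[M] (theta t)) ψ = A⁻¹ * g M (Real.cos ψ) := by
    intro M
    induction M with
    | zero => intro ψ _; simpa using hθ ψ
    | succ M ih =>
      intro ψ hψ
      rw [Function.iterate_succ_apply']
      have he : negD^[M] (theta t) =ᶠ[𝓝 ψ] fun ψ => A⁻¹ * g M (Real.cos ψ) := by
        filter_upwards [isOpen_Ioo.mem_nhds hψ] with y hy using ih y hy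
      have hd : HasDerivAt (fun ψ => A⁻¹ * g M (Real.cos ψ))
          (A⁻¹ * (g (M + 1) (Real.cos ψ) * (-Real.sin ψ))) ψ :=
        ((hg M _ (hmem ψ)).2.comp ψ (Real.hasDerivAt_cos ψ)).const_mul _
      change -(deriv (negD^[M] (theta t)) ψ / Real.sin ψ) = _
      rw [he.deriv_eq, hd.deriv]
      have := (Real.sin_pos_of_pos_of_lt_pi hψ.1 hψ.2).ne'
      field_simp
  rw [hD M φ hφ, hθ φ]
  have t0 := (hg 0 _ (hmem φ)).1
  have tM := (hg M _ (hmem φ)).1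
  have i1 := le_of_tendsto_of_tendsto (t0.const_mul lo) tM hlo
  have i2 := le_of_tendsto_of_tendsto tM (t0.const_mul hi) hhi
  have hA' : 0 ≤ A⁻¹ := by positivity
  constructor
  · calc _ = A⁻¹ * (lo * g 0 (Real.cos φ)) := by ring
      _ ≤ _ := mul_le_mul_of_nonneg_left i1 hA'
  · calc _ ≤ A⁻¹ * (hi * g 0 (Real.cos φ)) := mul_le_mul_of_nonneg_left i2 hA'
      _ = _ := by ring

lemma den_pos {t x : ℝ} (hx : -1 < x) (n : ℕ) : 0 < al t n + be t n * x := by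
  unfold al be
  have hE : 0 < Real.exp (-t) ^ (2 * n + 1) := by positivity
  rw [mul_comm 2 (2 * n + 1), pow_mul]
  generalize Real.exp (-t) ^ (2 * n + 1) = E at *
  nlinarith [sq_nonneg (1 - E), mul_pos hE (by linarith : 0 < 1 + x)]

lemma be_nonneg (t : ℝ) (n : ℕ) : 0 ≤ be t n := by unfold be; positivity

lemma b_eq (t x : ℝ) (hx : -1 < x) (n : ℕ) :
    be t n / (al t n + be t n * x) = 1 / (x + Real.cosh ((2 * n + 1) * t)) := by
  have h := den_pos (t := t) hx n
  have h1 : 0 < x + Real.cosh ((2 * n + 1) * t) := by linarith [Real.one_le_cosh ((2 * n + 1) * t)]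
  rw [div_eq_div_iff h.ne' h1.ne', Real.cosh_eq]
  unfold al be
  have e1 : Real.exp (-t) ^ (2 * n + 1) = Real.exp (-((2 * n + 1) * t)) := by
    rw [← Real.exp_nat_mul]; congr 1; push_cast; ring
  rw [mul_comm 2 (2 * n + 1), pow_mul, e1]
  have e2 : Real.exp (-((2 * n + 1) * t)) * Real.exp ((2 * n + 1) * t) = 1 := by
    rw [← Real.exp_add]; simp
  linear_combination e2

lemma den_lower {t u : ℝ} (ht : 0 < t) (hu : 0 < u) (hu' : u ≤ Real.pi) (n : ℕ) :
    (u + (n + 1) * t) ^ 2 / 16 ≤ -Real.cos u + Real.cosh ((2 * n + 1) * t) := by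
  have h1 := Real.cos_le_one_sub_mul_cos_sq (x := u) (by rwa [abs_of_pos hu])
  have h2 : 1 + ((2 * n + 1) * t) ^ 2 / 2 ≤ Real.cosh ((2 * n + 1) * t) := by
    have hy : 0 ≤ (2 * (n : ℝ) + 1) * t := by positivity
    generalize (2 * (n : ℝ) + 1) * t = y at hy
    have e : y = 2 * (y / 2) := by ring
    have hs : y / 2 ≤ Real.sinh (y / 2) := Real.self_le_sinh_iff.2 (by positivity)
    have hc : Real.cosh y = 1 + 2 * Real.sinh (y / 2) ^ 2 := by
      conv_lhs => rw [e]
      rw [Real.cosh_two_mul, Real.cosh_sq]; ring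
    rw [hc]; nlinarith
  have h3 : (1 : ℝ) / 8 ≤ 2 / Real.pi ^ 2 := by
    rw [div_le_div_iff₀ (by norm_num) (by positivity)]
    nlinarith [Real.pi_lt_four, Real.pi_pos]
  have h4 : u ^ 2 / 8 ≤ 2 / Real.pi ^ 2 * u ^ 2 := by nlinarith [sq_nonneg u]
  have h5 : ((n + 1) * t) ^ 2 ≤ ((2 * n + 1) * t) ^ 2 := by
    gcongr; linarith [(Nat.cast_nonneg n : (0 : ℝ) ≤ n)]
  nlinarith [sq_nonneg (u - (n + 1) * t), sq_nonneg ((n + 1) * t)]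

lemma sum_upper {t u : ℝ} (ht : 0 < t) (hu : 0 < u) (hu' : u ≤ Real.pi) (m : ℕ) :
    ∑ n ∈ Finset.range m, 1 / (-Real.cos u + Real.cosh ((2 * n + 1) * t)) ≤ 32 / (t * (t + u)) := by
  have key : ∀ m : ℕ, ∑ n ∈ Finset.range m, 1 / (-Real.cos u + Real.cosh ((2 * n + 1) * t)) ≤
      32 / t * (1 / (t + u) - 1 / (u + (m + 1) * t)) := by
    intro m
    induction m with
    | zero => simp [add_comm]
    | succ m ih =>
      rw [Finset.sum_range_succ]
      have hv : 0 < u + (m + 1) * t := by positivity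
      have h1 : 1 / (-Real.cos u + Real.cosh ((2 * m + 1) * t)) ≤ 1 / ((u + (m + 1) * t) ^ 2 / 16) :=
        one_div_le_one_div_of_le (by positivity) (den_lower ht hu hu' m)
      have h2 : 1 / ((u + (m + 1) * t) ^ 2 / 16) ≤
          32 / t * (1 / (u + (m + 1) * t) - 1 / (u + ((m + 1 : ℕ) + 1) * t)) := by
        push_cast
        have e : u + ((m : ℝ) + 1 + 1) * t = (u + (m + 1) * t) + t := by ring
        rw [e]
        have hvt : t ≤ u + (m + 1) * t := by nlinarith [(Nat.cast_nonneg m : (0 : ℝ) ≤ m)]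
        generalize u + ((m : ℝ) + 1) * t = v at *
        have : 32 / t * (1 / v - 1 / (v + t)) = 32 / (v * (v + t)) := by field_simp; ring
        rw [this, one_div_div, div_le_div_iff₀ (by positivity) (by positivity)]
        nlinarith [mul_pos hv hv]
      linarith
  refine (key m).trans ?_
  have : 0 ≤ 1 / (u + ((m : ℝ) + 1) * t) := by positivity
  calc _ ≤ 32 / t * (1 / (t + u)) := by gcongr; linarith
    _ = _ := by field_simp

lemma den_upper {t u T R : ℝ} (ht : 0 < t) (htT : t ≤ T) (hu : 0 < u) (hu' : u ≤ Real.pi) (n : ℕ)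
    (hR : (2 * n + 1) * t ≤ R * (t + u)) :
    -Real.cos u + Real.cosh ((2 * n + 1) * t) ≤
      (R ^ 2 * Real.exp ((R * (T + Real.pi)) ^ 2 / 2) + 1) * (t + u) ^ 2 := by
  have hpi := Real.pi_pos
  set y := (2 * (n : ℝ) + 1) * t with hy
  have hy0 : 0 ≤ y := by positivity
  have hR0 : 0 ≤ R := by
    by_contra h; push Not at h
    nlinarith [mul_pos (neg_pos.2 h) (by linarith : 0 < t + u)]
  have h1 := Real.cosh_le_exp_half_sq y
  have h2 := Real.one_sub_sq_div_two_le_cos (x := u)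
  have h3 : Real.exp (y ^ 2 / 2) - 1 ≤ y ^ 2 / 2 * Real.exp (y ^ 2 / 2) := by
    have := Real.add_one_le_exp (-(y ^ 2 / 2))
    have h := Real.exp_pos (y ^ 2 / 2)
    have e : Real.exp (-(y ^ 2 / 2)) * Real.exp (y ^ 2 / 2) = 1 := by rw [← Real.exp_add]; simp
    nlinarith
  have h4 : y ^ 2 ≤ R ^ 2 * (t + u) ^ 2 := by rw [← mul_pow]; gcongr
  have h5 : y ≤ R * (T + Real.pi) := hR.trans (by gcongr)
  have h6 : Real.exp (y ^ 2 / 2) ≤ Real.exp ((R * (T + Real.pi)) ^ 2 / 2) := by gcongr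
  have h7 : y ^ 2 / 2 * Real.exp (y ^ 2 / 2) ≤ R ^ 2 * (t + u) ^ 2 * Real.exp ((R * (T + Real.pi)) ^ 2 / 2) := by
    gcongr; linarith [sq_nonneg y]
  nlinarith

open Polynomial in
lemma negD_ratio (M : ℕ) (T : ℝ) : ∃ B : ℝ, 0 < B ∧ ∀ φ t : ℝ, φ ∈ Set.Ioo 0 Real.pi →
    0 < t → t ≤ T →
    (B / (t * (t + (Real.pi - φ)))) ^ M * theta t φ ≤ (negD^[M] (theta t)) φ ∧
    (negD^[M] (theta t)) φ ≤ (32 / (t * (t + (Real.pi - φ)))) ^ M * theta t φ := by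
  set R : ℝ := 2 * (M + 2) with hR
  set B : ℝ := R ^ 2 * Real.exp ((R * (T + Real.pi)) ^ 2 / 2) + 1 with hB
  have hBpos : 0 < B := by positivity
  refine ⟨B⁻¹, by positivity, fun φ t hφ ht htT => ?_⟩
  set u := Real.pi - φ with hu
  have hu0 : 0 < u := by linarith [hφ.2]
  have hu1 : u ≤ Real.pi := by linarith [hφ.1]
  have hcos : Real.cos φ = -Real.cos u := by rw [hu, Real.cos_pi_sub]; ring
  have hx : -1 < Real.cos φ := by
    rw [← Real.cos_pi]
    exact Real.cos_lt_cos_of_nonneg_of_le_pi hφ.1.le le_rfl hφ.2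
  have hl : ∀ n, 0 < al t n + be t n * Real.cos φ := fun n => den_pos hx n
  refine transfer ht M hφ _ _ ?_ ?_
  · set K : ℕ := M + ⌈(t + u) / t⌉₊ with hK
    have hKle : (K : ℝ) ≤ M + (t + u) / t + 1 := by
      rw [hK]; push_cast
      have := (Nat.ceil_lt_add_one (by positivity : 0 ≤ (t + u) / t)).le
      linarith
    have hbn : ∀ n ∈ Finset.range K, 1 / (B * (t + u) ^ 2) ≤ be t n / (al t n + be t n * Real.cos φ) := by
      intro n hn
      rw [b_eq t _ hx, hcos]
      have hnK : (n : ℝ) + 1 ≤ K := by exact_mod_cast Finset.mem_range.1 hn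
      refine one_div_le_one_div_of_le ?_ (den_upper ht htT hu0 hu1 n ?_)
      · rw [← hcos]; linarith [Real.one_le_cosh ((2 * n + 1) * t)]
      · have h1 : (n : ℝ) ≤ M + (t + u) / t := by linarith
        have h2 : (n : ℝ) * t ≤ M * t + (t + u) := by
          calc (n : ℝ) * t ≤ (M + (t + u) / t) * t := by gcongr
            _ = _ := by field_simp
        rw [hR]
        have : 0 ≤ (M : ℝ) * u := by positivity
        nlinarith
    filter_upwards [eventually_ge_atTop K] with m hm
    refine pq_lower _ _ _ (be_nonneg t) hl _ (by positivity) M _ fun r hr hc => ?_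
    have hcard : K ≤ (r ∩ Finset.range K).card + M := by
      have h1 : Finset.range K \ r ⊆ Finset.range m \ r :=
        Finset.sdiff_subset_sdiff (Finset.range_subset_range.2 hm) (Finset.Subset.refl r)
      have h2 := Finset.card_le_card h1
      have h3 := Finset.card_sdiff_add_card_inter (Finset.range K) r
      rw [Finset.card_range, Finset.inter_comm] at h3
      omega
    have hcard' : (t + u) / t ≤ ((r ∩ Finset.range K).card : ℝ) := by
      have h1 : ⌈(t + u) / t⌉₊ ≤ (r ∩ Finset.range K).card := by omega
      exact (Nat.le_ceil _).trans (by exact_mod_cast h1)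
    calc B⁻¹ / (t * (t + u)) = (t + u) / t * (1 / (B * (t + u) ^ 2)) := by
          have : t + u ≠ 0 := by positivity
          field_simp
      _ ≤ ((r ∩ Finset.range K).card : ℝ) * (1 / (B * (t + u) ^ 2)) := by gcongr
      _ ≤ ∑ n ∈ r ∩ Finset.range K, be t n / (al t n + be t n * Real.cos φ) := by
          rw [← nsmul_eq_mul]
          exact Finset.card_nsmul_le_sum _ _ _ fun n hn => hbn n (Finset.mem_inter.1 hn).2
      _ ≤ _ := Finset.sum_le_sum_of_subset_of_nonneg Finset.inter_subset_left
          fun n _ _ => div_nonneg (be_nonneg t n) (hl n).le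
  · refine Eventually.of_forall fun m => ?_
    refine (pq_upper _ _ _ (be_nonneg t) hl M _).trans ?_
    have h0 : 0 ≤ eval (Real.cos φ) (pq (al t) (be t) (Finset.range m)) := by
      rw [pq_eval]; exact Finset.prod_nonneg fun i _ => (hl i).le
    have hs : ∑ n ∈ Finset.range m, be t n / (al t n + be t n * Real.cos φ) ≤ 32 / (t * (t + u)) := by
      refine le_trans (le_of_eq (Finset.sum_congr rfl fun n _ => ?_)) (sum_upper ht hu0 hu1 m)
      rw [b_eq t _ hx, hcos]
    have hs0 : 0 ≤ ∑ n ∈ Finset.range m, be t n / (al t n + be t n * Real.cos φ) :=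
      Finset.sum_nonneg fun n _ => div_nonneg (be_nonneg t n) (hl n).le
    gcongr

lemma theta_bounds (T : ℝ) (hT : 0 < T) : ∃ C : ℝ, 0 < C ∧ ∀ φ t : ℝ, φ ∈ Set.Ioo 0 Real.pi →
    0 < t → t ≤ T → W t φ ≤ theta t φ ∧ theta t φ ≤ C * W t φ := by
  have hpi := Real.pi_pos
  set a := Real.pi ^ 2 / T with ha
  have ha0 : 0 < a := by positivity
  have hs : Summable (fun n : ℤ => Real.exp a * Real.exp (-a) ^ n.natAbs) := by
    refine Summable.mul_left _ ?_
    have h : Summable (fun n : ℕ => Real.exp (-a) ^ n) :=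
      summable_geometric_of_lt_one (Real.exp_pos _).le (by simpa using ha0)
    refine Summable.of_nat_of_neg ?_ ?_ <;> simpa using h
  refine ⟨∑' n : ℤ, Real.exp a * Real.exp (-a) ^ n.natAbs, ?_, fun φ t hφ ht htT => ?_⟩
  · exact hs.tsum_pos (fun n => by positivity) 0 (by positivity)
  have hW : ∀ x, 0 ≤ W t x := fun x => by unfold W; positivity
  have hle : ∀ n : ℤ, W t (φ + 2 * Real.pi * n) ≤ (Real.exp a * Real.exp (-a) ^ n.natAbs) * W t φ := by
    intro n
    unfold W
    have : Real.exp (-(φ + 2 * Real.pi * n) ^ 2 / (4 * t)) ≤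
        Real.exp a * Real.exp (-a) ^ n.natAbs * Real.exp (-φ ^ 2 / (4 * t)) := by
      rw [← Real.exp_nat_mul, ← Real.exp_add, ← Real.exp_add]
      apply Real.exp_le_exp.2
      have hk : ((n.natAbs : ℕ) : ℝ) = |(n : ℝ)| := by rw [Nat.cast_natAbs]; simp
      rw [hk]
      set k := |(n : ℝ)| with hk'
      have hk2 : (n : ℝ) ^ 2 = k ^ 2 := by rw [hk', sq_abs]
      have hnk : -k ≤ (n : ℝ) := neg_abs_le _
      have hk0 : 0 ≤ k := abs_nonneg _
      have hint : 0 ≤ k * (k - 1) := by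
        rcases eq_or_ne n 0 with h | h
        · simp [hk', h]
        · have : (1 : ℝ) ≤ k := by rw [hk']; exact_mod_cast Int.one_le_abs h
          exact mul_nonneg hk0 (by linarith)
      have h1 : -(φ + 2 * Real.pi * n) ^ 2 / (4 * t) = -φ ^ 2 / (4 * t) - Real.pi * (n * φ + Real.pi * k ^ 2) / t := by
        rw [← hk2]; field_simp; ring
      have h2 : Real.pi * (Real.pi * (k * (k - 1))) / t ≤ Real.pi * (n * φ + Real.pi * k ^ 2) / t := by
        have : -k * Real.pi ≤ n * φ := by
          have := mul_le_mul_of_nonneg_right hnk hφ.1.le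
          have := mul_le_mul_of_nonneg_left hφ.2.le hk0
          linarith
        gcongr
        nlinarith
      have h3 : a * (k * (k - 1)) ≤ Real.pi * (Real.pi * (k * (k - 1))) / t := by
        calc a * (k * (k - 1)) = Real.pi ^ 2 * (k * (k - 1)) / T := by rw [ha]; ring
          _ ≤ Real.pi ^ 2 * (k * (k - 1)) / t := by gcongr
          _ = _ := by ring
      rw [h1]
      nlinarith [mul_nonneg ha0.le (sq_nonneg (k - 1))]
    calc _ ≤ 1 / Real.sqrt (4 * Real.pi * t) * (Real.exp a * Real.exp (-a) ^ n.natAbs * Real.exp (-φ ^ 2 / (4 * t))) := by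
          gcongr
      _ = _ := by ring
  have hs2 : Summable (fun n : ℤ => W t (φ + 2 * Real.pi * n)) :=
    Summable.of_nonneg_of_le (fun n => hW _) hle (hs.mul_right _)
  constructor
  · have := hs2.le_tsum 0 (fun n _ => hW _)
    simpa [theta] using this
  · rw [← tsum_mul_right]
    exact hs2.tsum_le_tsum hle (hs.mul_right _)

lemma sin_bounds {φ : ℝ} (hφ : φ ∈ Set.Ioo 0 Real.pi) :
    2 / Real.pi ^ 2 * (φ * (Real.pi - φ)) ≤ Real.sin φ ∧ Real.sin φ ≤ φ * (Real.pi - φ) := by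
  have key : ∀ ψ : ℝ, 0 < ψ → ψ ≤ Real.pi / 2 →
      2 / Real.pi ^ 2 * (ψ * (Real.pi - ψ)) ≤ Real.sin ψ ∧ Real.sin ψ ≤ ψ * (Real.pi - ψ) := by
    intro ψ h0 h1
    have hpi := Real.pi_gt_three
    constructor
    · refine le_trans ?_ (Real.mul_le_sin h0.le h1)
      calc _ ≤ 2 / Real.pi ^ 2 * (ψ * Real.pi) := by gcongr; linarith
        _ = _ := by field_simp
    · refine (Real.sin_le h0.le).trans ?_
      nlinarith
  rcases le_total φ (Real.pi / 2) with h | h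
  · exact key φ hφ.1 h
  · have := key (Real.pi - φ) (by linarith [hφ.2]) (by linarith)
    rw [Real.sin_pi_sub] at this
    have e : (Real.pi - φ) * (Real.pi - (Real.pi - φ)) = φ * (Real.pi - φ) := by ring
    rwa [e] at this

/-- Sharp two-sided estimate for `-d/dφ K_t^{2N+1}(φ)`, expressed through
`(2π)^{-N} e^{tN²} · sin φ · ((-D)^{N+1} θ_t)(φ)`, for `0 < t ≤ T`. -/
theorem sphere_heat_kernel_derivative_sharp_estimate_small_time (N : ℕ) (T : ℝ) (hT : 0 < T) :
    ∃ c C : ℝ, 0 < c ∧ 0 < C ∧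
      ∀ φ t : ℝ, φ ∈ Set.Ioo 0 Real.pi → 0 < t → t ≤ T →
        c * (φ * (Real.pi - φ)) * (t + Real.pi - φ) ^ (-((N : ℝ) + 1)) *
            t ^ (-((2 * (N : ℝ) + 1) / 2 + 1)) * Real.exp (-φ ^ 2 / (4 * t)) ≤
          (2 * Real.pi) ^ (-(N : ℝ)) * Real.exp (t * (N : ℝ) ^ 2) * Real.sin φ *
            (negD^[N + 1] (theta t)) φ ∧
        (2 * Real.pi) ^ (-(N : ℝ)) * Real.exp (t * (N : ℝ) ^ 2) * Real.sin φ *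
            (negD^[N + 1] (theta t)) φ ≤
          C * (φ * (Real.pi - φ)) * (t + Real.pi - φ) ^ (-((N : ℝ) + 1)) *
            t ^ (-((2 * (N : ℝ) + 1) / 2 + 1)) * Real.exp (-φ ^ 2 / (4 * t)) := by
  have hpi := Real.pi_pos
  obtain ⟨B, hB, hr⟩ := negD_ratio (N + 1) T
  obtain ⟨C, hC, hθ⟩ := theta_bounds T hT
  set κ : ℝ := (2 * Real.pi) ^ (-(N : ℝ)) with hκ
  have hκ0 : 0 < κ := by positivity
  set w : ℝ := 1 / Real.sqrt (4 * Real.pi) with hw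
  have hw0 : 0 < w := by positivity
  refine ⟨κ * (2 / Real.pi ^ 2) * B ^ (N + 1) * w,
    κ * Real.exp (T * (N : ℝ) ^ 2) * 32 ^ (N + 1) * C * w, by positivity, by positivity, ?_⟩
  intro φ t hφ ht htT
  obtain ⟨r1, r2⟩ := hr φ t hφ ht htT
  obtain ⟨t1, t2⟩ := hθ φ t hφ ht htT
  obtain ⟨s1, s2⟩ := sin_bounds hφ
  have hu : 0 < Real.pi - φ := by linarith [hφ.2]
  have hφ0 : 0 < φ := hφ.1
  have hv : t + Real.pi - φ = t + (Real.pi - φ) := by ring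
  rw [hv]
  generalize Real.pi - φ = u at *
  have p1 : (t + u) ^ (-((N : ℝ) + 1)) = ((t + u) ^ (N + 1))⁻¹ := by
    rw [Real.rpow_neg (by positivity), ← Real.rpow_natCast]; push_cast; rfl
  have p2 : t ^ (-((2 * (N : ℝ) + 1) / 2 + 1)) = (t ^ (N + 1))⁻¹ * (Real.sqrt t)⁻¹ := by
    have : -((2 * (N : ℝ) + 1) / 2 + 1) = -((N + 1 : ℕ) : ℝ) + -(1 / 2) := by push_cast; ring
    rw [this, Real.rpow_add ht, Real.rpow_neg ht.le, Real.rpow_neg ht.le, Real.rpow_natCast,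
      Real.sqrt_eq_rpow]
  have hWe : W t φ = w * (Real.sqrt t)⁻¹ * Real.exp (-φ ^ 2 / (4 * t)) := by
    unfold W
    rw [Real.sqrt_mul (by positivity), hw]
    simp only [one_div, mul_inv]
  have hdiv : ∀ b : ℝ, (b / (t * (t + u))) ^ (N + 1) = b ^ (N + 1) * ((t + u) ^ (N + 1))⁻¹ * (t ^ (N + 1))⁻¹ := by
    intro b; rw [div_pow, mul_pow, div_eq_mul_inv, mul_inv]; ring
  have hE0 : 0 < Real.exp (-φ ^ 2 / (4 * t)) := Real.exp_pos _
  have hW0 : 0 ≤ W t φ := by unfold W; positivity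
  have hx1 : 1 ≤ Real.exp (t * (N : ℝ) ^ 2) := Real.one_le_exp (by positivity)
  have hx2 : Real.exp (t * (N : ℝ) ^ 2) ≤ Real.exp (T * (N : ℝ) ^ 2) := by gcongr
  have hF1 : (B / (t * (t + u))) ^ (N + 1) * W t φ ≤ (negD^[N + 1] (theta t)) φ :=
    (mul_le_mul_of_nonneg_left t1 (by positivity)).trans r1
  have hF2 : (negD^[N + 1] (theta t)) φ ≤ (32 / (t * (t + u))) ^ (N + 1) * (C * W t φ) :=
    r2.trans (mul_le_mul_of_nonneg_left t2 (by positivity))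
  have hF0 : 0 ≤ (negD^[N + 1] (theta t)) φ := le_trans (by positivity) hF1
  have hsin0 : 0 ≤ Real.sin φ := le_trans (by positivity) s1
  generalize (negD^[N + 1] (theta t)) φ = F at *
  rw [p1, p2]
  constructor
  · calc _ = κ * 1 * (2 / Real.pi ^ 2 * (φ * u)) * ((B / (t * (t + u))) ^ (N + 1) * W t φ) := by
          rw [hdiv, hWe]; ring
      _ ≤ _ := by gcongr
  · calc _ ≤ κ * Real.exp (T * (N : ℝ) ^ 2) * (φ * u) * ((32 / (t * (t + u))) ^ (N + 1) * (C * W t φ)) := by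
          gcongr
      _ = _ := by rw [hdiv, hWe]; ring
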